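/- PEP certificates yield worst-case bounds for fixed-step first-order methods on smooth convex functions: let L > 0, let N, d be natural numbers, let α_{i,k} ∈ R for 0 ≤ k < i ≤ N, and set I = {0, …, N, *}. Define u_i = e_{i+1} ∈ R^{N+2} for i = 0, …, N, u* = 0, h_0 = e_{N+2}, h_i = e_{N+2} − Σ_{k=0}^{i−1} α_{i,k} e_{k+1} for i = 1, …, N, h* = 0, and for i, j ∈ I the symmetric (N+2)×(N+2) matrix A_{i,j}(α) = (1/2)( u_j (h_i − h_j)ᵀ + (h_i − h_j) u_jᵀ ) + (1/(2L)) (u_i − u_j)(u_i − u_j)ᵀ; let v_i = e_{i+1} ∈ R^{N+1} for i = 0, …, N and v* = 0. Suppose τ ≥ 0 and λ_{i,j} ≥ 0 for i, j ∈ I satisfy the dual feasibility conditions τ h_0 h_0ᵀ + Σ_{i,j∈I} λ_{i,j} A_{i,j}(α) ⪰ 0 and v_N = Σ_{i,j∈I} λ_{i,j} (v_j − v_i). Then for every differentiable convex function f : R^d → R with L-Lipschitz gradient attaining its minimum at x* ∈ R^d, and every x_0 ∈ R^d, the iterates x_i = x_0 − Σ_{k=0}^{i−1} α_{i,k} ∇f(x_k),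 i = 1, …, N, satisfy f(x_N) − f(x*) ≤ τ ‖x_0 − x*‖². -/

import Mathlib

open Matrix

section Smooth

variable {E : Type*} [NormedAddCommGroup E] [InnerProductSpace ℝ E] [CompleteSpace E]
  {f : E → ℝ} {L : ℝ}

theorem hasDerivAt_comp_lineMap_gradient (hf : Differentiable ℝ f) (x y : E)
    (t : ℝ) :
    HasDerivAt (fun s : ℝ => f (AffineMap.lineMap x y s))
      (inner ℝ (gradient f (AffineMap.lineMap x y t)) (y - x)) t := by
  rw [inner_gradient_left]
  exact (hf _).hasFDerivAt.comp_hasDerivAt t AffineMap.hasDerivAt_lineMap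

theorem ConvexOn.add_inner_gradient_le (hc : ConvexOn ℝ Set.univ f) (hf : Differentiable ℝ f)
    (x y : E) : f x + inner ℝ (gradient f x) (y - x) ≤ f y := by
  have hline : ConvexOn ℝ Set.univ (fun s : ℝ => f (AffineMap.lineMap x y s)) := by
    simpa [Function.comp_def] using hc.comp_affineMap (AffineMap.lineMap (k := ℝ) x y)
  have h := hline.le_slope_of_hasDerivAt (Set.mem_univ 0) (Set.mem_univ 1) one_pos
    (hasDerivAt_comp_lineMap_gradient hf x y 0)
  simp only [slope_def_field, AffineMap.lineMap_apply_zero, AffineMap.lineMap_apply_one,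
    sub_zero, div_one] at h
  linarith

/-- The descent lemma for functions with Lipschitz gradient. -/
theorem LipschitzWith.le_add_inner_gradient_add_sq (hL : 0 ≤ L) (hf : Differentiable ℝ f)
    (hlip : LipschitzWith L.toNNReal (gradient f)) (x y : E) :
    f y ≤ f x + inner ℝ (gradient f x) (y - x) + L / 2 * ‖y - x‖ ^ 2 := by
  have hderiv : ∀ t : ℝ, HasDerivAt
      (fun s : ℝ => f (AffineMap.lineMap x y s) - s * inner ℝ (gradient f x) (y - x)
        - s ^ 2 * (L / 2 * ‖y - x‖ ^ 2))
      (inner ℝ (gradient f (AffineMap.lineMap x y t)) (y - x)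
        - 1 * inner ℝ (gradient f x) (y - x) - 2 * t * (L / 2 * ‖y - x‖ ^ 2)) t := fun t => by
    refine HasDerivAt.congr_deriv (((hasDerivAt_comp_lineMap_gradient hf x y t).sub
      ((hasDerivAt_id t).mul_const (inner ℝ (gradient f x) (y - x)))).sub
      ((hasDerivAt_pow 2 t).mul_const (L / 2 * ‖y - x‖ ^ 2))) ?_
    simp
  have hanti := antitoneOn_of_deriv_nonpos (convex_Icc (0 : ℝ) 1)
    (fun t _ => (hderiv t).continuousAt.continuousWithinAt)
    (fun t _ => (hderiv t).differentiableAt.differentiableWithinAt) (fun t ht => by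
      have ht0 : 0 ≤ t := (interior_subset ht).1
      have hdist : ‖gradient f (AffineMap.lineMap x y t) - gradient f x‖ ≤ L * (t * ‖y - x‖) := by
        have h := hlip.norm_sub_le (AffineMap.lineMap x y t) x
        rw [Real.coe_toNNReal L hL] at h
        simpa [AffineMap.lineMap_apply, norm_smul, abs_of_nonneg ht0] using h
      have hinner : inner ℝ (gradient f (AffineMap.lineMap x y t)) (y - x)
          - inner ℝ (gradient f x) (y - x) ≤ L * (t * ‖y - x‖) * ‖y - x‖ := by
        rw [← inner_sub_left]
        exact (real_inner_le_norm _ _).trans (by gcongr)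
      rw [(hderiv t).deriv]
      linarith)
  have h := hanti (Set.left_mem_Icc.2 zero_le_one) (Set.right_mem_Icc.2 zero_le_one) zero_le_one
  simp only [AffineMap.lineMap_apply_zero, AffineMap.lineMap_apply_one] at h
  linarith

/-- The interpolation inequality for convex functions with `L`-Lipschitz gradient. -/
theorem ConvexOn.inner_gradient_add_sq_le_sub (hL : 0 < L) (hc : ConvexOn ℝ Set.univ f)
    (hf : Differentiable ℝ f) (hlip : LipschitzWith L.toNNReal (gradient f)) (x y : E) :
    inner ℝ (gradient f y) (x - y) + 1 / (2 * L) * ‖gradient f x - gradient f y‖ ^ 2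
      ≤ f x - f y := by
  set D := gradient f x - gradient f y with hD
  have hlower := hc.add_inner_gradient_le hf y (x - (1 / L) • D)
  have hupper := hlip.le_add_inner_gradient_add_sq hL.le hf x (x - (1 / L) • D)
  have hsplit : inner ℝ (gradient f y) (x - (1 / L) • D - y)
      = inner ℝ (gradient f y) (x - y) - 1 / L * inner ℝ (gradient f y) D := by
    rw [sub_right_comm, inner_sub_right, real_inner_smul_right]
  have hdiff : inner ℝ (gradient f x) D - inner ℝ (gradient f y) D = ‖D‖ ^ 2 := by
    rw [← inner_sub_left, ← hD, real_inner_self_eq_norm_sq]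
  have hstep : x - (1 / L) • D - x = -((1 / L) • D) := by abel
  rw [hstep, norm_neg, inner_neg_right, real_inner_smul_right, norm_smul, mul_pow,
    Real.norm_eq_abs, sq_abs] at hupper
  rw [hsplit] at hlower
  have hcoef : L / 2 * ((1 / L) ^ 2 * ‖D‖ ^ 2) = 1 / L * ‖D‖ ^ 2 - 1 / (2 * L) * ‖D‖ ^ 2 := by
    field_simp
    ring
  linear_combination hlower + hupper + hcoef - (1 / L) * hdiff

end Smooth

section Gram

variable {n E : Type*} [Fintype n] [NormedAddCommGroup E] [InnerProductSpace ℝ E]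

/-- The pairing `M ↦ tr (M G)` of a matrix with the Gram matrix `G` of the family `P`. -/
def gramPairing (P : n → E) : Matrix n n ℝ →ₗ[ℝ] ℝ where
  toFun M := ∑ a, ∑ b, M a b * inner ℝ (P a) (P b)
  map_add' M M' := by simp [add_mul, Finset.sum_add_distrib]
  map_smul' c M := by simp [Finset.mul_sum, mul_assoc]

theorem gramPairing_vecMulVec (P : n → E) (w z : n → ℝ) :
    gramPairing P (vecMulVec w z) =
      inner ℝ (Fintype.linearCombination ℝ P w) (Fintype.linearCombination ℝ P z) := by
  simp only [gramPairing, LinearMap.coe_mk, AddHom.coe_mk, vecMulVec_apply,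
    Fintype.linearCombination_apply, sum_inner, inner_sum, real_inner_smul_left,
    real_inner_smul_right, mul_assoc]
  rw [Finset.sum_comm]
  exact Finset.sum_congr rfl fun _ _ => Finset.sum_congr rfl fun _ _ => mul_left_comm _ _ _

theorem Matrix.PosSemidef.gramPairing_nonneg {ι : Type*} [Fintype ι] {M : Matrix n n ℝ}
    (hM : M.PosSemidef) (P : n → EuclideanSpace ℝ ι) : 0 ≤ gramPairing P M := by
  have h : gramPairing P M = ∑ c, star (fun a => P a c) ⬝ᵥ (M *ᵥ fun a => P a c) := by
    simp only [gramPairing, LinearMap.coe_mk, AddHom.coe_mk, PiLp.inner_apply, dotProduct,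
      mulVec, Finset.mul_sum]
    simp_rw [Finset.sum_comm (s := (Finset.univ : Finset ι))]
    refine Finset.sum_congr rfl fun a _ => Finset.sum_congr rfl fun b _ =>
      Finset.sum_congr rfl fun c _ => ?_
    simp
    ring
  rw [h]
  exact Finset.sum_nonneg fun c _ => hM.dotProduct_mulVec_nonneg _

end Gram

/-- PEP certificates yield worst-case bounds for fixed-step first-order
methods on `L`-smooth convex functions: any dual-feasible pair `(τ, λ)` of
the performance estimation SDP certifies `f(x_N) - f(x*) ≤ τ ‖x₀ - x*‖²`.
The index `none` plays the role of `*`. -/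
theorem pep_certificate_bound_smooth_convex
    (L : ℝ) (hL : 0 < L) (N d : ℕ)
    (α : Fin (N + 1) → Fin (N + 1) → ℝ)
    (u : Option (Fin (N + 1)) → Fin (N + 2) → ℝ)
    (hu : ∀ i : Fin (N + 1), u (some i) = Pi.single i.castSucc 1)
    (hustar : u none = 0)
    (hvec : Option (Fin (N + 1)) → Fin (N + 2) → ℝ)
    (hhvec : ∀ i : Fin (N + 1), hvec (some i) =
      Pi.single (Fin.last (N + 1)) 1
        - ∑ k ∈ Finset.univ.filter (fun k => k < i),
            α i k • (Pi.single (Fin.castSucc k) 1 : Fin (N + 2) → ℝ))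
    (hhstar : hvec none = 0)
    (A : Option (Fin (N + 1)) → Option (Fin (N + 1)) →
      Matrix (Fin (N + 2)) (Fin (N + 2)) ℝ)
    (hA : ∀ i j, A i j =
      (1 / 2 : ℝ) • (vecMulVec (u j) (hvec i - hvec j)
          + vecMulVec (hvec i - hvec j) (u j))
        + (1 / (2 * L)) • vecMulVec (u i - u j) (u i - u j))
    (v : Option (Fin (N + 1)) → Fin (N + 1) → ℝ)
    (hv : ∀ i : Fin (N + 1), v (some i) = Pi.single i 1)
    (hvstar : v none = 0)
    (τ : ℝ) (hτ : 0 ≤ τ)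
    (lam : Option (Fin (N + 1)) → Option (Fin (N + 1)) → ℝ)
    (hlam : ∀ i j, 0 ≤ lam i j)
    (hdual1 : (τ • vecMulVec (hvec (some 0)) (hvec (some 0))
        + ∑ i, ∑ j, lam i j • A i j).PosSemidef)
    (hdual2 : v (some (Fin.last N)) = ∑ i, ∑ j, lam i j • (v j - v i)) :
    ∀ f : EuclideanSpace ℝ (Fin d) → ℝ,
      ConvexOn ℝ Set.univ f →
      Differentiable ℝ f →
      LipschitzWith L.toNNReal (gradient f) →
      ∀ xstar : EuclideanSpace ℝ (Fin d), (∀ y, f xstar ≤ f y) →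
      ∀ (x₀ : EuclideanSpace ℝ (Fin d)) (x : Fin (N + 1) → EuclideanSpace ℝ (Fin d)),
        (∀ i, x i = x₀ - ∑ k ∈ Finset.univ.filter (fun k => k < i),
            α i k • gradient f (x k)) →
        f (x (Fin.last N)) - f xstar ≤ τ * ‖x₀ - xstar‖ ^ 2 := by
  intro f hc hf hlip xstar hmin x₀ x hx
  let P : Fin (N + 2) → EuclideanSpace ℝ (Fin d) :=
    Fin.snoc (fun i => gradient f (x i)) (x₀ - xstar)
  let pt : Option (Fin (N + 1)) → EuclideanSpace ℝ (Fin d) := fun i => i.elim xstar x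
  have hgrad_star : gradient f xstar = 0 := by
    have h : IsLocalMin f xstar := Filter.Eventually.of_forall hmin
    simp [gradient, h.fderiv_eq_zero]
  have hPu : ∀ i, Fintype.linearCombination ℝ P (u i) = gradient f (pt i) := by
    rintro (_ | i)
    · simp [hustar, pt, hgrad_star]
    · simp [hu, pt, P]
  have hPh : ∀ i, Fintype.linearCombination ℝ P (hvec i) = pt i - xstar := by
    rintro (_ | i)
    · simp [hhstar, pt]
    · simp only [hhvec, map_sub, map_sum, map_smul, Fintype.linearCombination_apply_single,
        one_smul, P, Fin.snoc_last, Fin.snoc_castSucc, pt, Option.elim_some]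
      rw [hx i, sub_right_comm]
  have hA_le : ∀ i j, gramPairing P (A i j) ≤ f (pt i) - f (pt j) := fun i j => by
    refine le_of_eq_of_le ?_ (hc.inner_gradient_add_sq_le_sub hL hf hlip (pt i) (pt j))
    simp only [hA, map_add, map_smul, gramPairing_vecMulVec, map_sub, hPu, hPh,
      sub_sub_sub_cancel_right, smul_eq_mul, real_inner_self_eq_norm_sq]
    rw [real_inner_comm (gradient f (pt j)) (pt i - pt j)]
    ring
  have hvalues : f (x (Fin.last N)) - f xstar
      = ∑ i, ∑ j, lam i j * (f (pt j) - f (pt i)) := by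
    have hF : ∀ i, Fintype.linearCombination ℝ (fun k => f (x k) - f xstar) (v i)
        = f (pt i) - f xstar := by
      rintro (_ | i)
      · simp [hvstar, pt]
      · simp [hv, pt]
    have h := congrArg (Fintype.linearCombination ℝ (fun k => f (x k) - f xstar)) hdual2
    simp only [map_sum, map_smul, map_sub, hF, sub_sub_sub_cancel_right, smul_eq_mul] at h
    exact h
  have hx0 : x 0 = x₀ := by rw [hx 0]; simp
  have hpos := hdual1.gramPairing_nonneg P
  simp only [map_add, map_smul, map_sum, gramPairing_vecMulVec, hPh, smul_eq_mul,
    real_inner_self_eq_norm_sq, pt, Option.elim_some, hx0] at hpos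
  have hsum : ∑ i, ∑ j, lam i j * gramPairing P (A i j)
      ≤ ∑ i, ∑ j, lam i j * (f (pt i) - f (pt j)) :=
    Finset.sum_le_sum fun i _ => Finset.sum_le_sum fun j _ =>
      mul_le_mul_of_nonneg_left (hA_le i j) (hlam i j)
  have hneg : ∑ i, ∑ j, lam i j * (f (pt j) - f (pt i))
      = -∑ i, ∑ j, lam i j * (f (pt i) - f (pt j)) := by
    simp only [← Finset.sum_neg_distrib, ← mul_neg, neg_sub]
  linarith
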